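/- Let 0 < α ≤ 1 and let h belong to the class G(α). Then there exists a probability measure μ on the unit circle 𝕋 = {ζ ∈ ℂ : |ζ| = 1} such that h'(z) = exp(α·∫_𝕋 Log(1 − ζz) dμ(ζ)) for all z in the open unit disk 𝔻, where Log denotes the principal branch of the logarithm. -/

import Mathlib

open Complex Metric

/-- The class `G(α)`: analytic functions `h` on the unit disk with `h(0) = 0`, `h'(0) = 1`,
`h'(z) ≠ 0` on the disk, and `Re (z h''(z) / (α h'(z))) < 1/2` on the disk. -/
noncomputable def GClass (α : ℝ) (h : ℂ → ℂ) : Prop :=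
  AnalyticOnNhd ℂ h (ball (0:ℂ) 1) ∧ h 0 = 0 ∧ deriv h 0 = 1 ∧
    (∀ z ∈ ball (0:ℂ) 1, deriv h z ≠ 0) ∧
    ∀ z ∈ ball (0:ℂ) 1, (z * deriv (deriv h) z / ((α : ℂ) * deriv h z)).re < 1/2

lemma aux_avg {k : ℂ → ℂ} (hk : DiffContOnCl ℂ k (ball 0 1)) {w : ℂ} (hw : w ∈ ball (0:ℂ) 1) :
    Real.circleAverage (fun ξ : ℂ => ((1 - 2 * (ξ * k ξ).re : ℝ) : ℂ) * (ξ - w)⁻¹) 0 1 = - k w := by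
  have hcl : closure (ball (0:ℂ) 1) = closedBall 0 1 := closure_ball _ one_ne_zero
  have hw1 : ‖w‖ < 1 := by simpa using hw
  have hkc : ContinuousOn k (sphere 0 1) := (hk.2.mono (by rw [hcl]; exact sphere_subset_closedBall))
  have hne : ∀ ξ ∈ closure (ball (0:ℂ) 1), 1 - (starRingEnd ℂ) w * ξ ≠ 0 := by
    intro ξ hξ h0
    rw [hcl] at hξ
    have hξ1 : ‖ξ‖ ≤ 1 := by simpa using hξ
    have h1 : (starRingEnd ℂ) w * ξ = 1 := (sub_eq_zero.1 h0).symm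
    have h2 : ‖w‖ * ‖ξ‖ = 1 := by
      have := congrArg norm h1
      simpa using this
    nlinarith [norm_nonneg w, norm_nonneg ξ]
  have hneξ : ∀ ξ ∈ sphere (0:ℂ) 1, ξ - w ≠ 0 := by
    intro ξ hξ h0
    have : ‖ξ‖ = 1 := by simpa using hξ
    rw [sub_eq_zero.1 h0] at this
    linarith
  set g : ℂ → ℂ := fun ξ => (1 - (starRingEnd ℂ) w * ξ)⁻¹ • (ξ - ξ ^ 2 * k ξ) with hg
  have hdc : DiffContOnCl ℂ g (ball 0 1) := by
    have h1 : DiffContOnCl ℂ (fun ξ => 1 - (starRingEnd ℂ) w * ξ) (ball 0 1) :=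
      Differentiable.diffContOnCl (by fun_prop)
    have h2 : DiffContOnCl ℂ (fun ξ : ℂ => ξ) (ball 0 1) := differentiable_id.diffContOnCl
    have h3 : DiffContOnCl ℂ (fun ξ : ℂ => ξ ^ 2) (ball 0 1) :=
      Differentiable.diffContOnCl (by fun_prop)
    exact (h1.inv hne).smul (h2.sub (h3.smul hk))
  have hgavg : Real.circleAverage g 0 1 = 0 := by
    rw [DiffContOnCl.circleAverage (by simpa using hdc)]
    simp [hg]
  have hgint : CircleIntegrable g 0 1 :=
    ContinuousOn.circleIntegrable zero_le_one
      (hdc.2.mono (by rw [hcl]; exact sphere_subset_closedBall))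
  have hconj : Real.circleAverage (fun ξ => (starRingEnd ℂ) (g ξ)) 0 1 = 0 := by
    have := ContinuousLinearMap.circleAverage_comp_comm (conjCLE : ℂ →L[ℝ] ℂ) hgint
    rw [hgavg, map_zero] at this
    exact this
  have hcau : Real.circleAverage (fun z => ((z - 0) / (z - w)) • k z) 0 1 = k w :=
    DiffContOnCl.circleAverage_smul_div (by simpa using hk) (by simpa using hw)
  have hcint : CircleIntegrable (fun ξ => (starRingEnd ℂ) (g ξ)) 0 1 :=
    ContinuousOn.circleIntegrable zero_le_one
      (continuous_conj.comp_continuousOn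
        (hdc.2.mono (by rw [hcl]; exact sphere_subset_closedBall)))
  have hint2 : CircleIntegrable (fun z => ((z - 0) / (z - w)) • k z) 0 1 := by
    apply ContinuousOn.circleIntegrable zero_le_one
    refine ContinuousOn.smul (ContinuousOn.div (by fun_prop) (by fun_prop) hneξ) hkc
  have := Real.circleAverage_fun_sub hcint hint2
  rw [hconj, hcau, zero_sub] at this
  rw [← this]
  apply Real.circleAverage_congr_sphere
  intro ξ hξ
  rw [abs_one] at hξ
  have h1 : ‖ξ‖ = 1 := by simpa using hξ
  have hξ0 : ξ ≠ 0 := by intro h; simp [h] at h1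
  have hc : (starRingEnd ℂ) ξ = ξ⁻¹ := by
    rw [Complex.inv_def, Complex.normSq_eq_norm_sq, h1]; simp
  have h5 := hneξ ξ hξ
  have h6 : 1 - w * ξ⁻¹ ≠ 0 := by
    intro h; apply h5; field_simp at h; simpa using h
  have hre : ((1 - 2 * (ξ * k ξ).re : ℝ) : ℂ) = 1 - (ξ * k ξ + ξ⁻¹ * (starRingEnd ℂ) (k ξ)) := by
    rw [← hc, ← map_mul, Complex.add_conj]; push_cast; ring
  simp only [hre, hg, smul_eq_mul, map_mul, map_inv₀, map_sub, map_one, map_pow, hc,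
    Complex.conj_conj, sub_zero]
  have h7 : (1 - w * ξ⁻¹)⁻¹ = ξ * (ξ - w)⁻¹ := by
    rw [show 1 - w * ξ⁻¹ = (ξ - w) * ξ⁻¹ by field_simp]
    rw [mul_inv, inv_inv, mul_comm]
  rw [h7]
  field_simp
  ring

lemma aux_meas {k : ℂ → ℂ} (hk : DiffContOnCl ℂ k (ball 0 1))
    (hre : ∀ ξ ∈ sphere (0:ℂ) 1, (ξ * k ξ).re ≤ 1 / 2) :
    ∃ μ : MeasureTheory.ProbabilityMeasure (sphere (0:ℂ) 1), ∀ w ∈ ball (0:ℂ) 1,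
      ∫ ζ : sphere (0:ℂ) 1, (ζ:ℂ) / (1 - ζ * w) ∂(μ : MeasureTheory.Measure (sphere (0:ℂ) 1))
        = - k w := by
  have hcl : closure (ball (0:ℂ) 1) = closedBall 0 1 := closure_ball _ one_ne_zero
  have hkc : ContinuousOn k (sphere 0 1) := (hk.2.mono (by rw [hcl]; exact sphere_subset_closedBall))
  have hmem : ∀ θ, circleMap 0 1 θ ∈ sphere (0:ℂ) 1 := fun θ => circleMap_mem_sphere 0 zero_le_one θ
  have hkθ : Continuous fun θ => k (circleMap 0 1 θ) :=
    hkc.comp_continuous (continuous_circleMap 0 1) hmem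
  set d : ℝ → ℝ := fun θ => (2 * Real.pi)⁻¹ * (1 - 2 * (circleMap 0 1 θ * k (circleMap 0 1 θ)).re)
    with hd
  have hrec : Continuous fun θ => (circleMap 0 1 θ * k (circleMap 0 1 θ)).re :=
    continuous_re.comp ((continuous_circleMap 0 1).mul hkθ)
  have hdc : Continuous d :=
    continuous_const.mul (continuous_const.sub (continuous_const.mul hrec))
  have hd0 : ∀ θ, 0 ≤ d θ := by
    intro θ
    have := hre _ (hmem θ)
    have h2 := Real.pi_pos
    apply mul_nonneg (by positivity)
    linarith
  have hdi : ∫ θ in (0:ℝ)..2 * Real.pi, d θ = 1 := by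
    have hkz : DiffContOnCl ℂ (fun ξ => ξ • k ξ) (ball 0 1) :=
      (differentiable_id.diffContOnCl).smul hk
    have h1 : Real.circleAverage (fun ξ => ξ • k ξ) 0 1 = 0 := by
      rw [DiffContOnCl.circleAverage (by simpa using hkz)]; simp
    have hi : CircleIntegrable (fun ξ => ξ • k ξ) 0 1 :=
      ContinuousOn.circleIntegrable zero_le_one
        (hkz.2.mono (by rw [hcl]; exact sphere_subset_closedBall))
    have h2 := ContinuousLinearMap.circleAverage_comp_comm reCLM hi
    rw [h1, map_zero, Real.circleAverage_def] at h2
    have h3 : ∫ θ in (0:ℝ)..2 * Real.pi, (circleMap 0 1 θ * k (circleMap 0 1 θ)).re = 0 := by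
      have h4 : (2 * Real.pi)⁻¹ ≠ 0 := by have := Real.pi_pos; positivity
      exact (smul_eq_zero.1 h2).resolve_left h4
    have hii : IntervalIntegrable (fun θ => 2 * (circleMap 0 1 θ * k (circleMap 0 1 θ)).re)
        MeasureTheory.volume 0 (2 * Real.pi) :=
      (continuous_const.mul hrec).intervalIntegrable _ _
    rw [hd, intervalIntegral.integral_const_mul, intervalIntegral.integral_sub intervalIntegrable_const
      hii, intervalIntegral.integral_const_mul, h3]
    have := Real.pi_pos
    simp
    field_simp
  set ν : MeasureTheory.Measure ℝ := (MeasureTheory.volume.restrict (Set.Ioc 0 (2 * Real.pi))).withDensity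
    (fun θ => ((d θ).toNNReal : ENNReal)) with hν
  have hdm : Measurable fun θ => (d θ).toNNReal := (hdc.measurable).real_toNNReal
  have hpi : (0:ℝ) ≤ 2 * Real.pi := by have := Real.pi_pos; positivity
  have hν1 : MeasureTheory.IsProbabilityMeasure ν := by
    constructor
    rw [hν, MeasureTheory.withDensity_apply _ MeasurableSet.univ, MeasureTheory.Measure.restrict_univ]
    rw [intervalIntegral.integral_of_le hpi] at hdi
    have := MeasureTheory.ofReal_integral_eq_lintegral_ofReal
      (μ := MeasureTheory.volume.restrict (Set.Ioc 0 (2 * Real.pi))) (f := d)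
      (hdc.integrableOn_Ioc) (Filter.Eventually.of_forall hd0)
    rw [hdi, ENNReal.ofReal_one] at this
    exact this.symm
  set ψ : ℝ → sphere (0:ℂ) 1 := fun θ => ⟨circleMap 0 1 (-θ), hmem _⟩ with hψ
  have hψc : Continuous ψ := by
    have := continuous_circleMap 0 1
    exact Continuous.subtype_mk (by fun_prop) _
  refine ⟨⟨ν.map ψ, MeasureTheory.Measure.isProbabilityMeasure_map hψc.aemeasurable⟩, ?_⟩
  intro w hw
  have hmeas : Measurable fun ζ : sphere (0:ℂ) 1 => (ζ:ℂ) / (1 - ζ * w) := by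
    have : Measurable fun ζ : sphere (0:ℂ) 1 => (ζ:ℂ) := measurable_subtype_coe
    fun_prop
  change ∫ ζ : sphere (0:ℂ) 1, (ζ:ℂ) / (1 - ζ * w) ∂(ν.map ψ) = - k w
  rw [MeasureTheory.integral_map hψc.aemeasurable hmeas.aestronglyMeasurable, hν,
    integral_withDensity_eq_integral_smul hdm, ← aux_avg hk hw, Real.circleAverage_def,
    intervalIntegral.integral_of_le hpi, ← MeasureTheory.integral_smul]
  congr 1
  ext1 θ
  have h1 : ((ψ θ : sphere (0:ℂ) 1) : ℂ) = (circleMap 0 1 θ)⁻¹ := by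
    simp [hψ, circleMap, Complex.exp_neg]
  have h0 : circleMap 0 1 θ ≠ 0 := circleMap_ne_center one_ne_zero
  rw [h1, NNReal.smul_def, Real.coe_toNNReal _ (hd0 θ), hd]
  have h2 : (circleMap 0 1 θ)⁻¹ / (1 - (circleMap 0 1 θ)⁻¹ * w) = (circleMap 0 1 θ - w)⁻¹ := by
    rw [show 1 - (circleMap 0 1 θ)⁻¹ * w = (circleMap 0 1 θ - w) * (circleMap 0 1 θ)⁻¹ by field_simp]
    rw [div_eq_mul_inv, mul_inv, inv_inv]
    field_simp
  rw [h2, mul_smul]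
  simp only [real_smul]

lemma aux_norm (ζ : sphere (0:ℂ) 1) : ‖(ζ:ℂ)‖ = 1 := by simp

lemma aux_ne (ζ : sphere (0:ℂ) 1) {z : ℂ} (hz : z ∈ ball (0:ℂ) 1) :
    0 < (1 - (ζ:ℂ) * z).re := by
  have h1 : ‖z‖ < 1 := by simpa using hz
  have h2 := Complex.re_le_norm ((ζ:ℂ) * z)
  rw [norm_mul, aux_norm] at h2
  simp only [sub_re, one_re]
  linarith

lemma aux_cont {z : ℂ} (hz : z ∈ ball (0:ℂ) 1) :
    Continuous fun ζ : sphere (0:ℂ) 1 => (ζ:ℂ) / (1 - ζ * z) := by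
  refine Continuous.div (by fun_prop) (by fun_prop) fun ζ h => ?_
  have := aux_ne ζ hz
  rw [h] at this
  simp at this

/-- limit measure -/
lemma aux_lim {q : ℂ → ℂ} (hq : DifferentiableOn ℂ q (ball 0 1))
    (hre : ∀ ξ ∈ ball (0:ℂ) 1, (ξ * q ξ).re ≤ 1 / 2) :
    ∃ μ : MeasureTheory.ProbabilityMeasure (sphere (0:ℂ) 1), ∀ w ∈ ball (0:ℂ) 1,
      ∫ ζ : sphere (0:ℂ) 1, (ζ:ℂ) / (1 - ζ * w) ∂(μ : MeasureTheory.Measure (sphere (0:ℂ) 1))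
        = - q w := by
  have hcl : closure (ball (0:ℂ) 1) = closedBall 0 1 := closure_ball _ one_ne_zero
  have hstep : ∀ r : ℝ, ∃ μ : MeasureTheory.ProbabilityMeasure (sphere (0:ℂ) 1),
      r ∈ Set.Ioo (0:ℝ) 1 → ∀ w ∈ ball (0:ℂ) 1,
      ∫ ζ : sphere (0:ℂ) 1, (ζ:ℂ) / (1 - ζ * w) ∂(μ : MeasureTheory.Measure (sphere (0:ℂ) 1))
        = - (r * q (r * w)) := by
    intro r
    by_cases hr : r ∈ Set.Ioo (0:ℝ) 1
    · have hin : ∀ ξ ∈ closedBall (0:ℂ) 1, (r:ℂ) * ξ ∈ ball (0:ℂ) 1 := by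
        intro ξ hξ
        have : ‖ξ‖ ≤ 1 := by simpa using hξ
        simp only [mem_ball_zero_iff, norm_mul, Complex.norm_real, Real.norm_of_nonneg hr.1.le]
        nlinarith [hr.1, hr.2]
      obtain ⟨μ, hμ⟩ := aux_meas (k := fun w => r * q (r * w))
        (by
          apply DifferentiableOn.diffContOnCl
          rw [hcl]
          exact (hq.comp (by fun_prop) hin).const_mul _)
        (by
          intro ξ hξ
          have := hre _ (hin ξ (sphere_subset_closedBall hξ))
          rwa [show ξ * (r * q (r * ξ)) = r * ξ * q (r * ξ) by ring])
      exact ⟨μ, fun _ => hμ⟩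
    · obtain ⟨μ, -⟩ := aux_meas (k := fun _ => 0) diffContOnCl_const (by simp)
      exact ⟨μ, fun h => absurd h hr⟩
  choose μs hμs using hstep
  let U : Ultrafilter ℝ := Ultrafilter.of (nhdsWithin 1 (Set.Iio 1))
  have hU : (U : Filter ℝ) ≤ nhdsWithin 1 (Set.Iio 1) := Ultrafilter.of_le _
  obtain ⟨μ, -, hμ⟩ := isCompact_univ.ultrafilter_le_nhds (U.map μs) (by simp)
  refine ⟨μ, fun w hw => ?_⟩
  have ht : Filter.Tendsto μs U (nhds μ) := hμ
  rw [MeasureTheory.ProbabilityMeasure.tendsto_iff_forall_integral_rclike_tendsto ℂ] at ht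
  have h1 := ht (BoundedContinuousFunction.mkOfCompact ⟨_, aux_cont hw⟩)
  simp only [BoundedContinuousFunction.mkOfCompact_apply, ContinuousMap.coe_mk] at h1
  have h2 : Filter.Tendsto (fun r : ℝ => - ((r:ℂ) * q (r * w))) U (nhds (- q w)) := by
    have hqc : ContinuousAt q (((1:ℝ):ℂ) * w) := by
      rw [ofReal_one, one_mul]
      exact (hq.continuousOn).continuousAt (isOpen_ball.mem_nhds hw)
    have h3 : ContinuousAt (fun r : ℝ => - ((r:ℂ) * q (r * w))) 1 := by
      refine ContinuousAt.neg (ContinuousAt.mul (by fun_prop) ?_)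
      exact ContinuousAt.comp (f := fun r : ℝ => (r:ℂ) * w) hqc (by fun_prop)
    have h4 := h3.tendsto
    simp only [ofReal_one, one_mul] at h4
    exact h4.mono_left (hU.trans nhdsWithin_le_nhds)
  refine tendsto_nhds_unique (h1.congr' ?_) h2
  have : Set.Ioo (0:ℝ) 1 ∈ nhdsWithin (1:ℝ) (Set.Iio 1) := Ioo_mem_nhdsLT zero_lt_one
  filter_upwards [hU this] with r hr
  exact hμs r hr w hw

lemma aux_log_cont {z : ℂ} (hz : z ∈ ball (0:ℂ) 1) :
    Continuous fun ζ : sphere (0:ℂ) 1 => Complex.log (1 - (ζ:ℂ) * z) := by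
  rw [continuous_iff_continuousAt]
  intro ζ
  exact ContinuousAt.clog (by fun_prop) (Or.inl (aux_ne ζ hz))

lemma aux_int (μ : MeasureTheory.Measure (sphere (0:ℂ) 1)) [MeasureTheory.IsProbabilityMeasure μ]
    {z : ℂ} (hz : z ∈ ball (0:ℂ) 1) :
    HasDerivAt (fun z => ∫ ζ : sphere (0:ℂ) 1, Complex.log (1 - (ζ : ℂ) * z) ∂μ)
      (∫ ζ : sphere (0:ℂ) 1, -((ζ:ℂ) / (1 - ζ * z)) ∂μ) z := by
  have hz1 : ‖z‖ < 1 := by simpa using hz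
  obtain ⟨R, hR1, hR2⟩ := exists_between hz1
  have hsub : ball (0:ℂ) R ⊆ ball 0 1 := ball_subset_ball hR2.le
  refine (hasDerivAt_integral_of_dominated_loc_of_deriv_le (s := ball (0:ℂ) R)
    (bound := fun _ => (1 - R)⁻¹)
    (F' := fun z (ζ : sphere (0:ℂ) 1) => -((ζ:ℂ) / (1 - ζ * z)))
    (isOpen_ball.mem_nhds (by simpa using hR1)) ?_ ?_ ?_ ?_ ?_ ?_).2
  · filter_upwards [isOpen_ball.mem_nhds hz] with x hx
    exact (aux_log_cont hx).aestronglyMeasurable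
  · exact (aux_log_cont hz).integrable_of_hasCompactSupport (HasCompactSupport.of_compactSpace _)
  · exact (aux_cont hz).neg.aestronglyMeasurable
  · refine Filter.Eventually.of_forall fun ζ x hx => ?_
    have hx1 : ‖x‖ < R := by simpa using hx
    rw [norm_neg, norm_div, aux_norm, one_div]
    apply inv_anti₀ (by linarith)
    have := norm_sub_norm_le (1:ℂ) ((ζ:ℂ) * x)
    rw [norm_mul, aux_norm, norm_one] at this
    linarith
  · exact MeasureTheory.integrable_const _
  · refine Filter.Eventually.of_forall fun ζ x hx => ?_
    have h1 : HasDerivAt (fun x : ℂ => 1 - (ζ:ℂ) * x) (-(ζ:ℂ)) x := by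
      simpa using ((hasDerivAt_id x).const_mul (ζ:ℂ)).const_sub 1
    have := h1.clog (Or.inl (aux_ne ζ (hsub hx)))
    rwa [neg_div] at this

theorem stmt_4 {α : ℝ} (hα0 : 0 < α) (hα1 : α ≤ 1) {h : ℂ → ℂ} (hG : GClass α h) :
    ∃ μ : MeasureTheory.Measure (sphere (0:ℂ) 1), MeasureTheory.IsProbabilityMeasure μ ∧
      ∀ z ∈ ball (0:ℂ) 1,
        deriv h z =
          Complex.exp ((α : ℂ) * ∫ ζ : sphere (0:ℂ) 1, Complex.log (1 - (ζ : ℂ) * z) ∂μ) := by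
  obtain ⟨ha, -, h1, hne, hre⟩ := hG
  have hα : (α:ℂ) ≠ 0 := by exact_mod_cast hα0.ne'
  have hd1 : DifferentiableOn ℂ (deriv h) (ball 0 1) := ha.deriv.differentiableOn
  have hd2 : DifferentiableOn ℂ (deriv (deriv h)) (ball 0 1) := ha.deriv.deriv.differentiableOn
  obtain ⟨μ, hμ⟩ := aux_lim (q := fun z => deriv (deriv h) z / (α * deriv h z))
    (hd2.div (hd1.const_mul _) fun z hz => mul_ne_zero hα (hne z hz))
    (by
      intro z hz
      rw [← mul_div_assoc]
      exact (hre z hz).le)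
  refine ⟨μ, inferInstance, ?_⟩
  set L : ℂ → ℂ := fun z => ∫ ζ : sphere (0:ℂ) 1, Complex.log (1 - (ζ : ℂ) * z)
    ∂(μ : MeasureTheory.Measure (sphere (0:ℂ) 1)) with hL
  have hLd : ∀ z ∈ ball (0:ℂ) 1, HasDerivAt L (deriv (deriv h) z / (α * deriv h z)) z := by
    intro z hz
    have := aux_int (μ : MeasureTheory.Measure (sphere (0:ℂ) 1)) hz
    rwa [MeasureTheory.integral_neg, hμ z hz, neg_neg] at this
  have hQ : ∀ z ∈ ball (0:ℂ) 1,
      HasDerivAt (fun z => deriv h z * Complex.exp (-(α * L z))) 0 z := by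
    intro z hz
    have hh : HasDerivAt (deriv h) (deriv (deriv h) z) z :=
      (hd1.differentiableAt (isOpen_ball.mem_nhds hz)).hasDerivAt
    have := hh.mul (((hLd z hz).const_mul (α:ℂ)).neg.cexp)
    refine this.congr_deriv ?_
    have h3 : (α:ℂ) * (deriv (deriv h) z / (α * deriv h z)) = deriv (deriv h) z / deriv h z := by
      field_simp
    rw [h3, mul_left_comm, mul_neg, mul_div_cancel₀ _ (hne z hz)]
    ring
  intro z hz
  have h0 : (0:ℂ) ∈ ball (0:ℂ) 1 := by simp
  have := isOpen_ball.is_const_of_deriv_eq_zero (convex_ball (0:ℂ) 1).isPreconnected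
    (fun z hz => (hQ z hz).differentiableAt.differentiableWithinAt)
    (fun z hz => (hQ z hz).deriv) hz h0
  have hL0 : L 0 = 0 := by simp [hL]
  simp only [hL0, h1, mul_zero, neg_zero, Complex.exp_zero, mul_one] at this
  rw [Complex.exp_neg, mul_inv_eq_one₀ (Complex.exp_ne_zero _)] at this
  exact this
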